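/- Let n ≥ 3 and let u, v, m, w, x, y, z be real coefficients with u ≠ 0, v ≠ 0, m ≠ 0, x·y − w·z ≠ 0 and (n−2)(6w − v + 2u) − 2u ≠ 0. Set u' := 1/u, v' := 1/v, m' := 1/m, let (w', x'; y', z') be the entries of the inverse of the 2×2 matrix (w, x; y, z), and set p' := [ (n−3)(2(u−v)² + 3(uv + 2uw − 4vw)) + 3u(5v + 2w) ] / [ 2uv( (n−2)(6w − v + 2u) − 2u ) ]. Then, for every p ∈ V, the linear maps σP and σP' on H ⊕ Λ³ defined by σP(C,Ξ) := ( u·S¹C + ((v−u)/2)·S²C + (u/2 + w)·S³C + x·S⁷Ξ , y·Ŝ⁵C + m·Ŝ¹Ξ + ((m+z)/2)·Ŝ²Ξ ) and σP'(C,Ξ) := ( q·( u'·S¹C + ((v'−u')/2)·S²C + (u'/2 + w'/4)·S³C ) + (p' − (3/4)w')·S⁹C + (q·x'/2)·S⁷Ξ , (q·y'/2)·Ŝ⁵C + q·( m'·Ŝ¹Ξ + ((m'+z')/2)·Ŝ²Ξ ) ) are well defined (each of the listed symbol maps sends H into H, respectively Λ³ into Λ³, respectively maps between H and Λ³ as indicated),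 and they satisfy σP' ∘ σP = q³ · id on H ⊕ Λ³. (This is the principal-symbol content of the adjugate identity P'∘P = □³ + lower order terms establishing generalized normal hyperbolicity of the propagation operator P.) -/

import Mathlib

noncomputable section

/-- Trilinear tensors on `ℝⁿ`, in components. -/
abbrev Tens (n : ℕ) := Fin n → Fin n → Fin n → ℝ

/-- Lowered components `p_a := η_{ab} p^b`. -/
def pdn (n : ℕ) (η : Matrix (Fin n) (Fin n) ℝ) (p : Fin n → ℝ) (a : Fin n) : ℝ :=
  ∑ b, η a b * p b

/-- `q := p_a p^a`. -/
def qsq (n : ℕ) (η : Matrix (Fin n) (Fin n) ℝ) (p : Fin n → ℝ) : ℝ :=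
  ∑ a, pdn n η p a * p a

/-- For `C ∈ H`, the vector `m_c := p^e p^f C_{efc}`. -/
def mC (n : ℕ) (p : Fin n → ℝ) (C : Tens n) (c : Fin n) : ℝ :=
  ∑ e, ∑ f, p e * p f * C e f c

/-- For `Ξ ∈ Λ³`, the 2-form `Z_{ab} := p^c Ξ_{cab}`. -/
def Zp (n : ℕ) (p : Fin n → ℝ) (Ξ : Tens n) (a b : Fin n) : ℝ :=
  ∑ c, p c * Ξ c a b

/-- `ζ_c := p^d Z_{cd}`. -/
def zetaP (n : ℕ) (p : Fin n → ℝ) (Ξ : Tens n) (c : Fin n) : ℝ :=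
  ∑ d, p d * Zp n p Ξ c d

/-- Principal symbol of `P¹`: `S¹C_{abc} = q·C_{abc}`. -/
def S1 (n : ℕ) (η : Matrix (Fin n) (Fin n) ℝ) (p : Fin n → ℝ) (C : Tens n) : Tens n :=
  fun a b c => qsq n η p * C a b c

/-- Principal symbol of `P²`. -/
def S2 (n : ℕ) (η : Matrix (Fin n) (Fin n) ℝ) (p : Fin n → ℝ) (C : Tens n) : Tens n :=
  fun a b c =>
    pdn n η p b * (∑ d, p d * (C a d c + C c d a))
      - pdn n η p c * (∑ d, p d * (C a d b + C b d a))
      - (1/((n : ℝ)-1)) * (η a b * mC n p C c - η a c * mC n p C b)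

/-- Principal symbol of `P³`. -/
def S3 (n : ℕ) (η : Matrix (Fin n) (Fin n) ℝ) (p : Fin n → ℝ) (C : Tens n) : Tens n :=
  fun a b c =>
    2 * pdn n η p a * (∑ d, p d * C d c b)
      - pdn n η p b * (∑ d, p d * C d a c)
      + pdn n η p c * (∑ d, p d * C d a b)
      + (3/((n : ℝ)-1)) * (η a b * mC n p C c - η a c * mC n p C b)

/-- Principal symbol of `P⁹`. -/
def S9 (n : ℕ) (η : Matrix (Fin n) (Fin n) ℝ) (p : Fin n → ℝ) (C : Tens n) : Tens n :=
  fun a b c =>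
    (∑ e, ∑ f, p e * p f *
        (pdn n η p a * pdn n η p b * C e c f - pdn n η p a * pdn n η p c * C e b f))
      + (qsq n η p/((n : ℝ)-1)) * (η a b * mC n p C c - η a c * mC n p C b)

/-- Principal symbol of `P̂⁵`. -/
def S5hat (n : ℕ) (η : Matrix (Fin n) (Fin n) ℝ) (p : Fin n → ℝ) (C : Tens n) : Tens n :=
  fun a b c =>
    pdn n η p a * (∑ d, p d * C d b c) + pdn n η p b * (∑ d, p d * C d c a)
      + pdn n η p c * (∑ d, p d * C d a b)

/-- Principal symbol of `P⁷`. -/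
def S7 (n : ℕ) (η : Matrix (Fin n) (Fin n) ℝ) (p : Fin n → ℝ) (Ξ : Tens n) : Tens n :=
  fun a b c =>
    2 * pdn n η p a * Zp n p Ξ b c - pdn n η p b * Zp n p Ξ c a
      + pdn n η p c * Zp n p Ξ b a
      + (3/((n : ℝ)-1)) * (η a b * zetaP n p Ξ c - η c a * zetaP n p Ξ b)

/-- Principal symbol of `P̂¹`: `Ŝ¹Ξ_{abc} = q·Ξ_{abc}`. -/
def S1hat (n : ℕ) (η : Matrix (Fin n) (Fin n) ℝ) (p : Fin n → ℝ) (Ξ : Tens n) : Tens n :=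
  fun a b c => qsq n η p * Ξ a b c

/-- Principal symbol of `P̂²`. -/
def S2hat (n : ℕ) (η : Matrix (Fin n) (Fin n) ℝ) (p : Fin n → ℝ) (Ξ : Tens n) : Tens n :=
  fun a b c => -2 * (pdn n η p a * Zp n p Ξ b c + pdn n η p b * Zp n p Ξ c a
      + pdn n η p c * Zp n p Ξ a b)

/-- The hook space `H` of Young type (2,1): antisymmetric in the last two indices,
vanishing cyclic sum, vanishing `η`-trace. -/
def IsHook (n : ℕ) (ηinv : Matrix (Fin n) (Fin n) ℝ) (C : Tens n) : Prop :=
  (∀ a b c, C a b c = -(C a c b)) ∧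
  (∀ a b c, C a b c + C b c a + C c a b = 0) ∧
  (∀ c, ∑ a, ∑ b, ηinv a b * C a b c = 0)

/-- Totally antisymmetric trilinear tensors. -/
def IsAlt3 (n : ℕ) (Ξ : Tens n) : Prop :=
  (∀ a b c, Ξ a b c = -(Ξ a c b)) ∧ (∀ a b c, Ξ a b c = -(Ξ b a c))

/-- First (hook) component of the principal symbol `σP`. -/
def sigP1 (n : ℕ) (η : Matrix (Fin n) (Fin n) ℝ) (p : Fin n → ℝ)
    (u v w x : ℝ) (C Ξ : Tens n) : Tens n :=
  fun a b c =>
    u * S1 n η p C a b c + ((v-u)/2) * S2 n η p C a b c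
      + (u/2 + w) * S3 n η p C a b c + x * S7 n η p Ξ a b c

/-- Second (3-form) component of the principal symbol `σP`. -/
def sigP2 (n : ℕ) (η : Matrix (Fin n) (Fin n) ℝ) (p : Fin n → ℝ)
    (m y z : ℝ) (C Ξ : Tens n) : Tens n :=
  fun a b c =>
    y * S5hat n η p C a b c + m * S1hat n η p Ξ a b c
      + ((m+z)/2) * S2hat n η p Ξ a b c

/-- First (hook) component of the adjugate principal symbol `σP'`. -/
def sigP'1 (n : ℕ) (η : Matrix (Fin n) (Fin n) ℝ) (p : Fin n → ℝ)
    (u' v' w' x' p' : ℝ) (C Ξ : Tens n) : Tens n :=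
  fun a b c =>
    qsq n η p * (u' * S1 n η p C a b c + ((v'-u')/2) * S2 n η p C a b c
        + (u'/2 + w'/4) * S3 n η p C a b c)
      + (p' - (3/4)*w') * S9 n η p C a b c
      + (qsq n η p * x'/2) * S7 n η p Ξ a b c

/-- Second (3-form) component of the adjugate principal symbol `σP'`. -/
def sigP'2 (n : ℕ) (η : Matrix (Fin n) (Fin n) ℝ) (p : Fin n → ℝ)
    (m' y' z' : ℝ) (C Ξ : Tens n) : Tens n :=
  fun a b c =>
    (qsq n η p * y'/2) * S5hat n η p C a b c
      + qsq n η p * (m' * S1hat n η p Ξ a b c + ((m'+z')/2) * S2hat n η p Ξ a b c)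

/-- Contraction of a trilinear tensor with `p` in the middle slot. -/
def contrMid (n : ℕ) (p : Fin n → ℝ) (T : Tens n) (a c : Fin n) : ℝ :=
  ∑ d, p d * T a d c

section Contractions

variable {n : ℕ} {η ηinv : Matrix (Fin n) (Fin n) ℝ} {p : Fin n → ℝ} {C Ξ : Tens n}

theorem sum_mul_pdn : ∑ a, p a * pdn n η p a = qsq n η p := by
  simp only [qsq, mul_comm]

theorem sum_mul_eta (a : Fin n) : ∑ d, p d * η a d = pdn n η p a := by
  simp only [pdn, mul_comm]

theorem sum_mul_antisymm_eq_neg {F : Fin n → Fin n → ℝ} (hF : ∀ a b, F a b = -F b a)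
    (a : Fin n) : ∑ d, p d * F a d = -∑ d, p d * F d a := by
  rw [← Finset.sum_neg_distrib]
  exact Finset.sum_congr rfl fun d _ => by rw [hF a d]; ring

theorem sum_sum_mul_eq_zero {S F : Fin n → Fin n → ℝ} (hS : ∀ a b, S a b = S b a)
    (hF : ∀ a b, F a b = -F b a) : ∑ a, ∑ b, S a b * F a b = 0 := by
  have h : ∑ a, ∑ b, S a b * F a b = -∑ a, ∑ b, S a b * F a b := by
    conv_lhs => rw [Finset.sum_comm]
    simp only [← Finset.sum_neg_distrib]
    refine Finset.sum_congr rfl fun a _ => Finset.sum_congr rfl fun b _ => ?_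
    rw [hS b a, hF b a]
    ring
  linarith

theorem sum_mul_Zp (T : Tens n) (c : Fin n) : ∑ d, p d * Zp n p T d c = mC n p T c := by
  simp only [Zp, mC, Finset.mul_sum]
  rw [Finset.sum_comm]
  exact Finset.sum_congr rfl fun d _ => Finset.sum_congr rfl fun e _ => by ring

theorem sum_mul_contrMid (T : Tens n) (c : Fin n) :
    ∑ d, p d * contrMid n p T d c = mC n p T c := by
  simp only [contrMid, mC, Finset.mul_sum, mul_assoc]

theorem Zp_antisymm (hC : ∀ a b c, C a b c = -C a c b) (a b : Fin n) :
    Zp n p C a b = -Zp n p C b a := by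
  simp only [Zp, ← Finset.sum_neg_distrib]
  exact Finset.sum_congr rfl fun d _ => by rw [hC d a b]; ring

theorem Zp_eq_of_hook (hC : IsHook n ηinv C) (a b : Fin n) :
    Zp n p C a b = contrMid n p C a b - contrMid n p C b a := by
  simp only [Zp, contrMid, ← Finset.sum_sub_distrib]
  refine Finset.sum_congr rfl fun d _ => ?_
  linear_combination p d * hC.2.1 d a b - p d * hC.1 a b d

theorem sum_mul_contrMid_right (hC : ∀ a b c, C a b c = -C a c b) (a : Fin n) :
    ∑ d, p d * contrMid n p C a d = 0 := by
  simp only [contrMid, Finset.mul_sum, ← mul_assoc]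
  exact sum_sum_mul_eq_zero (fun _ _ => mul_comm _ _) fun d e => hC a e d

theorem sum_mul_Zp_right (hC : ∀ a b c, C a b c = -C a c b) (c : Fin n) :
    ∑ d, p d * Zp n p C c d = -mC n p C c := by
  rw [sum_mul_antisymm_eq_neg (Zp_antisymm hC), sum_mul_Zp]

theorem sum_mul_mC (hC : ∀ a b c, C a b c = -C a c b) : ∑ d, p d * mC n p C d = 0 := by
  simp only [← sum_mul_Zp, Finset.mul_sum, ← mul_assoc]
  exact sum_sum_mul_eq_zero (fun _ _ => mul_comm _ _) fun d e => Zp_antisymm hC e d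

theorem mC_eq_zero_of_alt (hΞ : IsAlt3 n Ξ) (c : Fin n) : mC n p Ξ c = 0 :=
  sum_sum_mul_eq_zero (fun _ _ => mul_comm _ _) fun d e => hΞ.2 d e c

theorem zetaP_eq_zero (hΞ : IsAlt3 n Ξ) (c : Fin n) : zetaP n p Ξ c = 0 := by
  rw [zetaP, sum_mul_Zp_right hΞ.1, mC_eq_zero_of_alt hΞ, neg_zero]

theorem S2_apply (C : Tens n) (a b c : Fin n) : S2 n η p C a b c =
    pdn n η p b * (contrMid n p C a c + contrMid n p C c a)
      - pdn n η p c * (contrMid n p C a b + contrMid n p C b a)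
      - (1/((n : ℝ)-1)) * (η a b * mC n p C c - η a c * mC n p C b) := by
  simp only [S2, contrMid, mul_add, Finset.sum_add_distrib]

theorem S3_apply (C : Tens n) (a b c : Fin n) : S3 n η p C a b c =
    2 * pdn n η p a * Zp n p C c b - pdn n η p b * Zp n p C a c + pdn n η p c * Zp n p C a b
      + (3/((n : ℝ)-1)) * (η a b * mC n p C c - η a c * mC n p C b) := rfl

theorem S5hat_apply (C : Tens n) (a b c : Fin n) : S5hat n η p C a b c =
    pdn n η p a * Zp n p C b c + pdn n η p b * Zp n p C c a + pdn n η p c * Zp n p C a b := rfl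

theorem S9_apply (hC : ∀ a b c, C a b c = -C a c b) (a b c : Fin n) : S9 n η p C a b c =
    pdn n η p a * pdn n η p c * mC n p C b - pdn n η p a * pdn n η p b * mC n p C c
      + (qsq n η p/((n : ℝ)-1)) * (η a b * mC n p C c - η a c * mC n p C b) := by
  simp only [S9, mC, Finset.mul_sum, ← Finset.sum_sub_distrib]
  congr 1
  refine Finset.sum_congr rfl fun e _ => Finset.sum_congr rfl fun f _ => ?_
  rw [hC e c f, hC e b f]
  ring

theorem S7_apply (hΞ : IsAlt3 n Ξ) (a b c : Fin n) : S7 n η p Ξ a b c =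
    2 * pdn n η p a * Zp n p Ξ b c - pdn n η p b * Zp n p Ξ c a
      + pdn n η p c * Zp n p Ξ b a := by
  simp only [S7, zetaP_eq_zero hΞ, mul_zero, sub_zero, add_zero]

end Contractions

section Traces

variable {n : ℕ} {η ηinv : Matrix (Fin n) (Fin n) ℝ} {p : Fin n → ℝ} {C Ξ : Tens n}

theorem inv_symm (hsymm : ∀ i j, η i j = η j i) (hinv : η * ηinv = 1) (i j : Fin n) :
    ηinv i j = ηinv j i := by
  have hη : η.transpose = η := Matrix.ext fun i j => hsymm j i
  have h1 : ηinv.transpose * η = 1 := by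
    rw [← hη, ← Matrix.transpose_mul, hinv, Matrix.transpose_one]
  have h2 : ηinv.transpose = ηinv := left_inv_eq_right_inv h1 hinv
  exact congrFun (congrFun h2 j) i

theorem sum_inv_mul_eta (hinv' : ηinv * η = 1) (a c : Fin n) :
    ∑ b, ηinv a b * η b c = if a = c then 1 else 0 := by
  rw [← Matrix.mul_apply, hinv', Matrix.one_apply]

theorem sum_inv_mul_pdn (hinv' : ηinv * η = 1) (a : Fin n) :
    ∑ b, ηinv a b * pdn n η p b = p a := by
  have h : ηinv.mulVec (η.mulVec p) = p := by
    rw [Matrix.mulVec_mulVec, hinv', Matrix.one_mulVec]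
  exact congrFun h a

/-- The trace of a bilinear form with respect to `ηinv`. -/
def trInv (ηinv : Matrix (Fin n) (Fin n) ℝ) (F : Fin n → Fin n → ℝ) : ℝ :=
  ∑ a, ∑ b, ηinv a b * F a b

theorem trInv_add (F G : Fin n → Fin n → ℝ) :
    trInv ηinv (fun a b => F a b + G a b) = trInv ηinv F + trInv ηinv G := by
  simp only [trInv, mul_add, Finset.sum_add_distrib]

theorem trInv_sub (F G : Fin n → Fin n → ℝ) :
    trInv ηinv (fun a b => F a b - G a b) = trInv ηinv F - trInv ηinv G := by
  simp only [trInv, mul_sub, Finset.sum_sub_distrib]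

theorem trInv_const_mul (r : ℝ) (F : Fin n → Fin n → ℝ) :
    trInv ηinv (fun a b => r * F a b) = r * trInv ηinv F := by
  simp only [trInv, Finset.mul_sum, mul_left_comm r]

theorem trInv_swap (hs : ∀ i j, ηinv i j = ηinv j i) (F : Fin n → Fin n → ℝ) :
    trInv ηinv (fun a b => F b a) = trInv ηinv F := by
  unfold trInv
  rw [Finset.sum_comm]
  exact Finset.sum_congr rfl fun a _ => Finset.sum_congr rfl fun b _ => by rw [hs b a]

theorem trInv_mul_pdn (hinv' : ηinv * η = 1) (g : Fin n → ℝ) :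
    trInv ηinv (fun a b => pdn n η p b * g a) = ∑ a, p a * g a := by
  simp only [trInv, ← mul_assoc, ← Finset.sum_mul, sum_inv_mul_pdn hinv']

theorem trInv_pdn_mul (hs : ∀ i j, ηinv i j = ηinv j i) (hinv' : ηinv * η = 1)
    (g : Fin n → ℝ) : trInv ηinv (fun a b => pdn n η p a * g b) = ∑ a, p a * g a := by
  rw [← trInv_mul_pdn hinv', ← trInv_swap hs]

theorem trInv_eta_mul (hsymm : ∀ i j, η i j = η j i) (hinv' : ηinv * η = 1) (r : ℝ) :
    trInv ηinv (fun a b => η a b * r) = n * r := by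
  have h : ∀ a, ∑ b, ηinv a b * η a b = 1 := fun a => by
    rw [Finset.sum_congr rfl fun b _ => congrArg (ηinv a b * ·) (hsymm a b),
      sum_inv_mul_eta hinv', if_pos rfl]
  simp [trInv, ← mul_assoc, ← Finset.sum_mul, h]

theorem trInv_eta_mul_right (hsymm : ∀ i j, η i j = η j i) (hinv : η * ηinv = 1)
    (hinv' : ηinv * η = 1) (c : Fin n) (g : Fin n → ℝ) :
    trInv ηinv (fun a b => η a c * g b) = g c := by
  rw [← trInv_swap (inv_symm hsymm hinv)]
  simp only [trInv, ← mul_assoc, ← Finset.sum_mul, sum_inv_mul_eta hinv']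
  simp

theorem trInv_antisymm (hs : ∀ i j, ηinv i j = ηinv j i) {F : Fin n → Fin n → ℝ}
    (hF : ∀ a b, F a b = -F b a) : trInv ηinv F = 0 :=
  sum_sum_mul_eq_zero hs hF

theorem trInv_contrMid (hC : IsHook n ηinv C) : trInv ηinv (contrMid n p C) = 0 := by
  have h : trInv ηinv (contrMid n p C) = -∑ d, p d * ∑ a, ∑ b, ηinv a b * C a b d := by
    simp only [trInv, contrMid, Finset.mul_sum, ← Finset.sum_neg_distrib]
    conv_rhs => rw [Finset.sum_comm]
    refine Finset.sum_congr rfl fun a _ => ?_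
    conv_rhs => rw [Finset.sum_comm]
    refine Finset.sum_congr rfl fun b _ => Finset.sum_congr rfl fun d _ => ?_
    rw [hC.1 a d b]
    ring
  rw [h]
  simp only [hC.2.2, mul_zero, Finset.sum_const_zero, neg_zero]

theorem isHook_S1 (hC : IsHook n ηinv C) : IsHook n ηinv (S1 n η p C) := by
  refine ⟨fun a b c => ?_, fun a b c => ?_, fun c => ?_⟩
  · simp only [S1]
    rw [hC.1 a b c, mul_neg]
  · simp only [S1]
    linear_combination qsq n η p * hC.2.1 a b c
  · change trInv ηinv (fun a b => qsq n η p * C a b c) = 0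
    rw [trInv_const_mul]
    exact mul_eq_zero_of_right _ (hC.2.2 c)

theorem trInv_eta_wedge (hn : (n : ℝ) - 1 ≠ 0) (hsymm : ∀ i j, η i j = η j i)
    (hinv : η * ηinv = 1) (hinv' : ηinv * η = 1) (r : ℝ) (g : Fin n → ℝ) (c : Fin n) :
    trInv ηinv (fun a b => r / ((n : ℝ) - 1) * (η a b * g c - η a c * g b)) = r * g c := by
  rw [trInv_const_mul, trInv_sub, trInv_eta_mul hsymm hinv',
    trInv_eta_mul_right hsymm hinv hinv']
  field_simp

theorem isHook_S2 (hn : (n : ℝ) - 1 ≠ 0) (hsymm : ∀ i j, η i j = η j i)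
    (hinv : η * ηinv = 1) (hinv' : ηinv * η = 1) (hC : IsHook n ηinv C) :
    IsHook n ηinv (S2 n η p C) := by
  have hs := inv_symm hsymm hinv
  refine ⟨fun a b c => ?_, fun a b c => ?_, fun c => ?_⟩
  · simp only [S2_apply]
    ring
  · simp only [S2_apply]
    rw [hsymm b a, hsymm c a, hsymm c b]
    ring
  · change trInv ηinv (fun a b => S2 n η p C a b c) = 0
    simp only [S2_apply]
    rw [trInv_sub, trInv_sub, trInv_const_mul, trInv_eta_wedge hn hsymm hinv hinv',
      trInv_mul_pdn hinv' fun a => contrMid n p C a c + contrMid n p C c a, trInv_add,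
      trInv_swap hs (fun a b => contrMid n p C a b), trInv_contrMid hC]
    simp only [mul_add, Finset.sum_add_distrib, sum_mul_contrMid, sum_mul_contrMid_right hC.1]
    ring

theorem isHook_S3 (hn : (n : ℝ) - 1 ≠ 0) (hsymm : ∀ i j, η i j = η j i)
    (hinv : η * ηinv = 1) (hinv' : ηinv * η = 1) (hC : IsHook n ηinv C) :
    IsHook n ηinv (S3 n η p C) := by
  have hs := inv_symm hsymm hinv
  have hA := Zp_antisymm (p := p) hC.1
  refine ⟨fun a b c => ?_, fun a b c => ?_, fun c => ?_⟩
  · simp only [S3_apply]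
    rw [hA c b]
    ring
  · simp only [S3_apply]
    rw [hsymm b a, hsymm c a, hsymm c b, hA b a, hA c a, hA c b]
    ring
  · change trInv ηinv (fun a b => S3 n η p C a b c) = 0
    simp only [S3_apply, mul_assoc]
    rw [trInv_add, trInv_add, trInv_sub, trInv_const_mul, trInv_const_mul,
      trInv_eta_wedge hn hsymm hinv hinv', trInv_pdn_mul hs hinv' fun b => Zp n p C c b,
      trInv_mul_pdn hinv' fun a => Zp n p C a c, trInv_antisymm hs hA,
      sum_mul_Zp_right hC.1, sum_mul_Zp]
    ring

theorem isHook_S9 (hn : (n : ℝ) - 1 ≠ 0) (hsymm : ∀ i j, η i j = η j i)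
    (hinv : η * ηinv = 1) (hinv' : ηinv * η = 1) (hC : IsHook n ηinv C) :
    IsHook n ηinv (S9 n η p C) := by
  have hs := inv_symm hsymm hinv
  refine ⟨fun a b c => ?_, fun a b c => ?_, fun c => ?_⟩
  · simp only [S9_apply hC.1]
    ring
  · simp only [S9_apply hC.1]
    rw [hsymm b a, hsymm c a, hsymm c b]
    ring
  · change trInv ηinv (fun a b => S9 n η p C a b c) = 0
    simp only [S9_apply hC.1, mul_assoc]
    rw [trInv_add, trInv_sub, trInv_eta_wedge hn hsymm hinv hinv',
      trInv_pdn_mul hs hinv' fun b => pdn n η p c * mC n p C b,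
      trInv_pdn_mul hs hinv' fun b => pdn n η p b * mC n p C c]
    simp only [← mul_assoc, ← Finset.sum_mul, sum_mul_pdn, mul_right_comm _ (pdn n η p c),
      sum_mul_mC hC.1]
    ring

theorem isHook_S7 (hsymm : ∀ i j, η i j = η j i)
    (hinv : η * ηinv = 1) (hinv' : ηinv * η = 1) (hΞ : IsAlt3 n Ξ) :
    IsHook n ηinv (S7 n η p Ξ) := by
  have hs := inv_symm hsymm hinv
  have hZ := Zp_antisymm (p := p) hΞ.1
  refine ⟨fun a b c => ?_, fun a b c => ?_, fun c => ?_⟩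
  · simp only [S7_apply hΞ]
    rw [hZ c a, hZ b a, hZ c b]
    ring
  · simp only [S7_apply hΞ]
    rw [hZ b a, hZ c a, hZ c b]
    ring
  · change trInv ηinv (fun a b => S7 n η p Ξ a b c) = 0
    simp only [S7_apply hΞ, mul_assoc]
    rw [trInv_add, trInv_sub, trInv_const_mul, trInv_const_mul,
      trInv_pdn_mul hs hinv' fun b => Zp n p Ξ b c,
      trInv_mul_pdn hinv' fun a => Zp n p Ξ c a, trInv_swap hs, trInv_antisymm hs hZ,
      sum_mul_Zp_right hΞ.1, sum_mul_Zp, mC_eq_zero_of_alt hΞ]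
    ring

theorem isAlt3_S5hat (hC : IsHook n ηinv C) : IsAlt3 n (S5hat n η p C) := by
  have hA := Zp_antisymm (p := p) hC.1
  constructor <;> intro a b c <;> simp only [S5hat_apply] <;>
    rw [hA b a, hA c b, hA c a] <;> ring

theorem isAlt3_S1hat (hΞ : IsAlt3 n Ξ) : IsAlt3 n (S1hat n η p Ξ) := by
  refine ⟨fun a b c => ?_, fun a b c => ?_⟩
  · simp only [S1hat]
    rw [hΞ.1 a b c, mul_neg]
  · simp only [S1hat]
    rw [hΞ.2 a b c, mul_neg]

theorem isAlt3_S2hat (hΞ : IsAlt3 n Ξ) : IsAlt3 n (S2hat n η p Ξ) := by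
  have hZ := Zp_antisymm (p := p) hΞ.1
  constructor <;> intro a b c <;> simp only [S2hat] <;>
    rw [hZ b a, hZ c b, hZ c a] <;> ring

theorem IsHook.add {D : Tens n} (hC : IsHook n ηinv C) (hD : IsHook n ηinv D) :
    IsHook n ηinv (fun a b c => C a b c + D a b c) := by
  refine ⟨fun a b c => ?_, fun a b c => ?_, fun c => ?_⟩
  · beta_reduce
    rw [hC.1 a b c, hD.1 a b c]
    ring
  · linear_combination hC.2.1 a b c + hD.2.1 a b c
  · simp only [mul_add, Finset.sum_add_distrib, hC.2.2, hD.2.2, add_zero]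

theorem IsHook.const_mul (r : ℝ) (hC : IsHook n ηinv C) :
    IsHook n ηinv (fun a b c => r * C a b c) := by
  refine ⟨fun a b c => ?_, fun a b c => ?_, fun c => ?_⟩
  · beta_reduce
    rw [hC.1 a b c, mul_neg]
  · linear_combination r * hC.2.1 a b c
  · simp only [mul_left_comm _ r, ← Finset.mul_sum, hC.2.2, mul_zero]

theorem IsAlt3.add {Φ : Tens n} (hΞ : IsAlt3 n Ξ) (hΦ : IsAlt3 n Φ) :
    IsAlt3 n (fun a b c => Ξ a b c + Φ a b c) := by
  refine ⟨fun a b c => ?_, fun a b c => ?_⟩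
  · beta_reduce
    rw [hΞ.1 a b c, hΦ.1 a b c, neg_add]
  · beta_reduce
    rw [hΞ.2 a b c, hΦ.2 a b c, neg_add]

theorem IsAlt3.const_mul (r : ℝ) (hΞ : IsAlt3 n Ξ) :
    IsAlt3 n (fun a b c => r * Ξ a b c) := by
  refine ⟨fun a b c => ?_, fun a b c => ?_⟩
  · beta_reduce
    rw [hΞ.1 a b c, mul_neg]
  · beta_reduce
    rw [hΞ.2 a b c, mul_neg]

end Traces

section Composition

variable {n : ℕ} {η ηinv : Matrix (Fin n) (Fin n) ℝ} {p : Fin n → ℝ} {C Ξ : Tens n}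

theorem contrMid_S2 (hC : IsHook n ηinv C) (a c : Fin n) :
    contrMid n p (S2 n η p C) a c =
      qsq n η p * (contrMid n p C a c + contrMid n p C c a) - pdn n η p c * mC n p C a
        - 1/((n : ℝ)-1) * (pdn n η p a * mC n p C c) := by
  have h : ∀ d, p d * S2 n η p C a d c =
      p d * pdn n η p d * (contrMid n p C a c + contrMid n p C c a)
        - pdn n η p c * (p d * contrMid n p C a d + p d * contrMid n p C d a)
        - 1/((n : ℝ)-1) * (p d * η a d * mC n p C c - η a c * (p d * mC n p C d)) := by
    intro d
    rw [S2_apply]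
    ring
  rw [contrMid]
  simp only [h, Finset.sum_sub_distrib, Finset.sum_add_distrib, ← Finset.mul_sum,
    ← Finset.sum_mul, sum_mul_pdn, sum_mul_eta, sum_mul_contrMid,
    sum_mul_contrMid_right hC.1, sum_mul_mC hC.1]
  ring

theorem contrMid_S3 (hC : IsHook n ηinv C) (a c : Fin n) :
    contrMid n p (S3 n η p C) a c =
      -(2 * pdn n η p a * mC n p C c) - qsq n η p * Zp n p C a c - pdn n η p c * mC n p C a
        + 3/((n : ℝ)-1) * (pdn n η p a * mC n p C c) := by
  have h : ∀ d, p d * S3 n η p C a d c =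
      2 * pdn n η p a * (p d * Zp n p C c d) - p d * pdn n η p d * Zp n p C a c
        + pdn n η p c * (p d * Zp n p C a d)
        + 3/((n : ℝ)-1) * (p d * η a d * mC n p C c - η a c * (p d * mC n p C d)) := by
    intro d
    rw [S3_apply]
    ring
  rw [contrMid]
  simp only [h, Finset.sum_sub_distrib, Finset.sum_add_distrib, ← Finset.mul_sum,
    ← Finset.sum_mul, sum_mul_pdn, sum_mul_eta, sum_mul_Zp_right hC.1, sum_mul_mC hC.1]
  ring

theorem contrMid_S7 (hΞ : IsAlt3 n Ξ) (a c : Fin n) :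
    contrMid n p (S7 n η p Ξ) a c = qsq n η p * Zp n p Ξ a c := by
  have h : ∀ d, p d * S7 n η p Ξ a d c =
      2 * pdn n η p a * (p d * Zp n p Ξ d c) - p d * pdn n η p d * Zp n p Ξ c a
        + pdn n η p c * (p d * Zp n p Ξ d a) := by
    intro d
    rw [S7_apply hΞ]
    ring
  rw [contrMid]
  simp only [h, Finset.sum_sub_distrib, Finset.sum_add_distrib, ← Finset.mul_sum,
    ← Finset.sum_mul, sum_mul_pdn, sum_mul_Zp, mC_eq_zero_of_alt hΞ,
    Zp_antisymm hΞ.1 c a]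
  ring

theorem Zp_S5hat (hC : IsHook n ηinv C) (b c : Fin n) :
    Zp n p (S5hat n η p C) b c =
      qsq n η p * Zp n p C b c - pdn n η p b * mC n p C c + pdn n η p c * mC n p C b := by
  have h : ∀ d, p d * S5hat n η p C d b c =
      p d * pdn n η p d * Zp n p C b c + pdn n η p b * (p d * Zp n p C c d)
        + pdn n η p c * (p d * Zp n p C d b) := by
    intro d
    rw [S5hat_apply]
    ring
  rw [Zp]
  simp only [h, Finset.sum_add_distrib, ← Finset.mul_sum,
    ← Finset.sum_mul, sum_mul_pdn, sum_mul_Zp, sum_mul_Zp_right hC.1]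
  ring

theorem Zp_S2hat (hΞ : IsAlt3 n Ξ) (b c : Fin n) :
    Zp n p (S2hat n η p Ξ) b c = -2 * qsq n η p * Zp n p Ξ b c := by
  have h : ∀ d, p d * S2hat n η p Ξ d b c =
      -2 * (p d * pdn n η p d * Zp n p Ξ b c + pdn n η p b * (p d * Zp n p Ξ c d)
        + pdn n η p c * (p d * Zp n p Ξ d b)) := by
    intro d
    rw [S2hat]
    ring
  rw [Zp]
  simp only [h, Finset.sum_add_distrib, ← Finset.mul_sum,
    ← Finset.sum_mul, sum_mul_pdn, sum_mul_Zp, sum_mul_Zp_right hΞ.1, mC_eq_zero_of_alt hΞ]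
  ring

theorem isHook_sigP1 (hn : (n : ℝ) - 1 ≠ 0) (hsymm : ∀ i j, η i j = η j i)
    (hinv : η * ηinv = 1) (hinv' : ηinv * η = 1) (u v w x : ℝ)
    (hC : IsHook n ηinv C) (hΞ : IsAlt3 n Ξ) : IsHook n ηinv (sigP1 n η p u v w x C Ξ) :=
  (((isHook_S1 hC).const_mul _).add ((isHook_S2 hn hsymm hinv hinv' hC).const_mul _)).add
    ((isHook_S3 hn hsymm hinv hinv' hC).const_mul _) |>.add
    ((isHook_S7 hsymm hinv hinv' hΞ).const_mul _)

theorem isAlt3_sigP2 (m y z : ℝ) (hC : IsHook n ηinv C) (hΞ : IsAlt3 n Ξ) :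
    IsAlt3 n (sigP2 n η p m y z C Ξ) :=
  ((isAlt3_S5hat hC).const_mul _).add ((isAlt3_S1hat hΞ).const_mul _) |>.add
    ((isAlt3_S2hat hΞ).const_mul _)

theorem contrMid_sigP1 (u v w x : ℝ) (hΞ : IsAlt3 n Ξ) (a c : Fin n) :
    contrMid n p (sigP1 n η p u v w x C Ξ) a c =
      u * (qsq n η p * contrMid n p C a c)
        + (v-u)/2 * contrMid n p (S2 n η p C) a c
        + (u/2 + w) * contrMid n p (S3 n η p C) a c
        + x * (qsq n η p * Zp n p Ξ a c) := by
  rw [← contrMid_S7 hΞ]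
  simp only [contrMid, Finset.mul_sum, ← Finset.sum_add_distrib]
  refine Finset.sum_congr rfl fun d _ => ?_
  rw [sigP1, S1]
  ring

theorem mC_sigP1 (u v w x : ℝ)
    (hC : IsHook n ηinv C) (hΞ : IsAlt3 n Ξ) (c : Fin n) :
    mC n p (sigP1 n η p u v w x C Ξ) c =
      (u * qsq n η p + (v-u)/2 * (qsq n η p * (1 - 1/((n : ℝ)-1)))
        + (u/2 + w) * (qsq n η p * (3/((n : ℝ)-1) - 3))) * mC n p C c := by
  have h : ∀ d, p d * contrMid n p (sigP1 n η p u v w x C Ξ) d c =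
      (u + (v-u)/2) * qsq n η p * (p d * contrMid n p C d c)
        + (v-u)/2 * (qsq n η p * (p d * contrMid n p C c d)
          - pdn n η p c * (p d * mC n p C d)
          - 1/((n : ℝ)-1) * (p d * pdn n η p d * mC n p C c))
        + (u/2 + w) * (-(2 * (p d * pdn n η p d * mC n p C c))
          - qsq n η p * (p d * Zp n p C d c) - pdn n η p c * (p d * mC n p C d)
          + 3/((n : ℝ)-1) * (p d * pdn n η p d * mC n p C c))
        + x * (qsq n η p * (p d * Zp n p Ξ d c)) := by
    intro d
    rw [contrMid_sigP1 u v w x hΞ, contrMid_S2 hC, contrMid_S3 hC]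
    ring
  rw [← sum_mul_contrMid]
  simp only [h, Finset.sum_sub_distrib, Finset.sum_add_distrib, Finset.sum_neg_distrib,
    ← Finset.mul_sum, ← Finset.sum_mul, sum_mul_pdn, sum_mul_contrMid,
    sum_mul_contrMid_right hC.1, sum_mul_Zp, sum_mul_mC hC.1, mC_eq_zero_of_alt hΞ]
  ring

theorem Zp_sigP1 (hn : (n : ℝ) - 1 ≠ 0) (hsymm : ∀ i j, η i j = η j i)
    (hinv : η * ηinv = 1) (hinv' : ηinv * η = 1) (u v w x : ℝ)
    (hC : IsHook n ηinv C) (hΞ : IsAlt3 n Ξ) (b c : Fin n) :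
    Zp n p (sigP1 n η p u v w x C Ξ) b c =
      -(2 * w * qsq n η p * Zp n p C b c) + 2 * x * qsq n η p * Zp n p Ξ b c
        + ((v-u)/2 * (1 - 1/((n : ℝ)-1)) + (u/2 + w) * (3/((n : ℝ)-1) - 1))
          * (pdn n η p b * mC n p C c - pdn n η p c * mC n p C b) := by
  rw [Zp_eq_of_hook (isHook_sigP1 hn hsymm hinv hinv' u v w x hC hΞ)]
  simp only [contrMid_sigP1 u v w x hΞ, contrMid_S2 hC, contrMid_S3 hC,
    Zp_eq_of_hook hC]
  rw [Zp_antisymm hΞ.1 c b]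
  ring

theorem Zp_sigP2 (m y z : ℝ) (hC : IsHook n ηinv C) (hΞ : IsAlt3 n Ξ) (b c : Fin n) :
    Zp n p (sigP2 n η p m y z C Ξ) b c =
      y * (qsq n η p * Zp n p C b c - pdn n η p b * mC n p C c + pdn n η p c * mC n p C b)
        - z * (qsq n η p * Zp n p Ξ b c) := by
  have h : Zp n p (sigP2 n η p m y z C Ξ) b c =
      y * Zp n p (S5hat n η p C) b c + m * (qsq n η p * Zp n p Ξ b c)
        + (m+z)/2 * Zp n p (S2hat n η p Ξ) b c := by
    simp only [Zp, Finset.mul_sum, ← Finset.sum_add_distrib]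
    refine Finset.sum_congr rfl fun d _ => ?_
    rw [sigP2, S1hat]
    ring
  rw [h, Zp_S5hat hC, Zp_S2hat hΞ]
  ring

end Composition

/-- The principal-symbol content of the adjugate identity `P'∘P = □³ + l.o.t.`:
the symbol maps preserve the spaces `H` and `Λ³` as indicated, and
`σP' ∘ σP = q³·id` on `H ⊕ Λ³`. -/
theorem sigP'_comp_sigP (n : ℕ) (hn : 3 ≤ n)
    (η ηinv : Matrix (Fin n) (Fin n) ℝ)
    (hsymm : ∀ i j, η i j = η j i)
    (hinv : η * ηinv = 1) (hinv' : ηinv * η = 1)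
    (u v m w x y z : ℝ)
    (hu : u ≠ 0) (hv : v ≠ 0) (hm : m ≠ 0)
    (hdet : x*y - w*z ≠ 0)
    (hden : ((n : ℝ)-2)*(6*w - v + 2*u) - 2*u ≠ 0)
    (u' v' m' w' x' y' z' p' : ℝ)
    (hu' : u' = 1/u) (hv' : v' = 1/v) (hm' : m' = 1/m)
    (hw' : w' = -z/(x*y - w*z)) (hx' : x' = x/(x*y - w*z))
    (hy' : y' = y/(x*y - w*z)) (hz' : z' = -w/(x*y - w*z))
    (hp' : p' = (((n : ℝ)-3)*(2*(u-v)^2 + 3*(u*v + 2*u*w - 4*v*w)) + 3*u*(5*v + 2*w))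
        / (2*u*v*(((n : ℝ)-2)*(6*w - v + 2*u) - 2*u)))
    (p : Fin n → ℝ) :
    -- well-definedness: the symbol maps send H to H and Λ³ to Λ³ as indicated
    (∀ C : Tens n, IsHook n ηinv C →
      IsHook n ηinv (S1 n η p C) ∧ IsHook n ηinv (S2 n η p C) ∧
      IsHook n ηinv (S3 n η p C) ∧ IsHook n ηinv (S9 n η p C) ∧
      IsAlt3 n (S5hat n η p C)) ∧
    (∀ Ξ : Tens n, IsAlt3 n Ξ →
      IsHook n ηinv (S7 n η p Ξ) ∧ IsAlt3 n (S1hat n η p Ξ) ∧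
      IsAlt3 n (S2hat n η p Ξ)) ∧
    -- the composite σP' ∘ σP equals q³·id on H ⊕ Λ³
    (∀ (C Ξ : Tens n), IsHook n ηinv C → IsAlt3 n Ξ → ∀ a b c,
      sigP'1 n η p u' v' w' x' p'
          (sigP1 n η p u v w x C Ξ) (sigP2 n η p m y z C Ξ) a b c
        = (qsq n η p)^3 * C a b c ∧
      sigP'2 n η p m' y' z'
          (sigP1 n η p u v w x C Ξ) (sigP2 n η p m y z C Ξ) a b c
        = (qsq n η p)^3 * Ξ a b c) := by
  have hn1 : (n : ℝ) - 1 ≠ 0 := by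
    have : (3 : ℝ) ≤ n := by exact_mod_cast hn
    linarith
  refine ⟨fun C hC => ⟨isHook_S1 hC, isHook_S2 hn1 hsymm hinv hinv' hC,
    isHook_S3 hn1 hsymm hinv hinv' hC, isHook_S9 hn1 hsymm hinv hinv' hC, isAlt3_S5hat hC⟩,
    fun Ξ hΞ => ⟨isHook_S7 hsymm hinv hinv' hΞ, isAlt3_S1hat hΞ, isAlt3_S2hat hΞ⟩,
    fun C Ξ hC hΞ a b c => ?_⟩
  have hD := isHook_sigP1 (p := p) hn1 hsymm hinv hinv' u v w x hC hΞ
  have hG := isAlt3_sigP2 (η := η) (p := p) m y z hC hΞ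
  have hA := Zp_antisymm (p := p) hC.1
  have hZ := Zp_antisymm (p := p) hΞ.1
  have huu : u' * u = 1 := by rw [hu', one_div_mul_cancel hu]
  have hvv : v' * v = 1 := by rw [hv', one_div_mul_cancel hv]
  have hmm : m' * m = 1 := by rw [hm', one_div_mul_cancel hm]
  have hww : w' * w + x' * y = 1 := by
    rw [hw', hx', div_mul_eq_mul_div, div_mul_eq_mul_div, ← add_div, div_eq_one_iff_eq hdet]
    ring
  have hwx : w' * x + x' * z = 0 := by
    rw [hw', hx']
    ring
  have hyw : y' * w + z' * y = 0 := by
    rw [hy', hz']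
    ring
  have hyx : y' * x + z' * z = 1 := by
    rw [hy', hz', div_mul_eq_mul_div, div_mul_eq_mul_div, ← add_div, div_eq_one_iff_eq hdet]
    ring
  constructor
  · obtain ⟨Δ, hΔ⟩ : ∃ Δ, Δ = ((n : ℝ)-2)*(6*w - v + 2*u) - 2*u := ⟨_, rfl⟩
    rw [← hΔ] at hden
    have hη : u' * (2*u - v/2 + 3*w) + (u + (v-u)/2 * (1 - 1/((n : ℝ)-1))
        + (u/2 + w) * (3/((n : ℝ)-1) - 3)) * (2*u' - v'/2 + p') = 0 := by
      rw [hu', hv', hp', ← hΔ]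
      field_simp
      rw [hΔ]
      ring
    have hpp : (v'-u')/2 * (-((v-u)/2 * (1 + 1/((n : ℝ)-1))) + (u/2 + w) * (3/((n : ℝ)-1) - 3))
        - 3/2 * u' * ((v-u)/2 * (1 - 1/((n : ℝ)-1)) + (u/2 + w) * (3/((n : ℝ)-1) - 1))
        - p' * (u + (v-u)/2 * (1 - 1/((n : ℝ)-1)) + (u/2 + w) * (3/((n : ℝ)-1) - 3))
        = 3/2 := by
      rw [hu', hv', hp', ← hΔ]
      field_simp
      rw [hΔ]
      ring
    rw [sigP'1, S2_apply, S3_apply, S9_apply hD.1, S7_apply hG]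
    simp only [Zp_sigP1 hn1 hsymm hinv hinv' u v w x hC hΞ, Zp_sigP2 m y z hC hΞ,
      contrMid_sigP1 u v w x hΞ, contrMid_S2 hC, contrMid_S3 hC, mC_sigP1 u v w x hC hΞ]
    rw [S1, sigP1, S1, S2_apply, S3_apply, S7_apply hΞ, hA c a, hA b a, hA c b,
      hZ c a, hZ b a, hZ c b]
    linear_combination qsq n η p ^ 3 * C a b c * huu
      + qsq n η p ^ 2 / 2 * (pdn n η p b * (contrMid n p C a c + contrMid n p C c a)
        - pdn n η p c * (contrMid n p C a b + contrMid n p C b a)) * (hvv - huu)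
      + qsq n η p ^ 2 / 2 * (-(2 * pdn n η p a * Zp n p C b c) - pdn n η p b * Zp n p C a c
        + pdn n η p c * Zp n p C a b) * (huu - hww)
      + qsq n η p ^ 2 / 2 * (-(2 * pdn n η p a * Zp n p Ξ b c) - pdn n η p b * Zp n p Ξ a c
        + pdn n η p c * Zp n p Ξ a b) * hwx
      + qsq n η p ^ 2 / ((n : ℝ)-1) * (η a b * mC n p C c - η a c * mC n p C b) * hη
      + qsq n η p * (pdn n η p a * pdn n η p b * mC n p C c
        - pdn n η p a * pdn n η p c * mC n p C b) * (hpp - 3/2 * hww)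
  · rw [sigP'2, S5hat_apply, S1hat, S2hat]
    simp only [Zp_sigP1 hn1 hsymm hinv hinv' u v w x hC hΞ, Zp_sigP2 m y z hC hΞ]
    rw [sigP2, S5hat_apply, S1hat, S2hat]
    linear_combination qsq n η p ^ 3 * Ξ a b c * hmm
      + qsq n η p ^ 2 * (pdn n η p a * Zp n p Ξ b c + pdn n η p b * Zp n p Ξ c a
        + pdn n η p c * Zp n p Ξ a b) * (hyx - hmm)
      - qsq n η p ^ 2 * (pdn n η p a * Zp n p C b c + pdn n η p b * Zp n p C c a
        + pdn n η p c * Zp n p C a b) * hyw
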